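/- arXiv:2410.08142 — 3 statements merged into one kernel-verified Lean document; each statement's English description precedes it below -/
import Mathlib

section
/- Let X be an arbitrary (n,k)-source. For any real ℓ ∈ [0,k] and real g > 0 such that m := k − ℓ + g is a (nonnegative) integer, and any ε ∈ (0,1], if f : {0,1}^n → {0,1}^m is a uniformly random function, then Pr_f[H_∞^ε(f(X)) < k − ℓ] ≤ 4 · 2^{−(εK/6)·( g − (1/⌊L⌋)·log₂(1/ε) − 16 )}, where K := 2^k and L := 2^ℓ. -/
open Finset Real
open scoped Classical

/-- Bit strings of length `n`, i.e. `{0,1}^n`. -/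
abbrev BS (n : ℕ) := Fin n → Bool

/-- `p` is a probability mass function on a finite type. -/
def IsDist {α : Type*} [Fintype α] (p : α → ℝ) : Prop :=
  (∀ a, 0 ≤ p a) ∧ ∑ a, p a = 1

/-- Pushforward of a mass function `p` on `{0,1}^n` along `f : {0,1}^n → {0,1}^m`:
the distribution of `f(X)` when `X ∼ p`. -/
noncomputable def pushforward {n m : ℕ} (f : BS n → BS m) (p : BS n → ℝ) : BS m → ℝ :=
  fun v => ∑ x ∈ Finset.univ.filter (fun x => f x = v), p x

/-- Statistical (total variation) distance between two mass functions. -/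
noncomputable def SD {α : Type*} [Fintype α] (p q : α → ℝ) : ℝ :=
  (∑ a, |p a - q a|) / 2

/-- The `ε`-smooth min-entropy of the mass function `p`: the supremum of all `k'`
such that `p` is `ε`-close (in statistical distance) to some distribution with
min-entropy at least `k'` (i.e., all point masses at most `2^(-k')`). -/
noncomputable def smoothMinEntropy {α : Type*} [Fintype α] (p : α → ℝ) (ε : ℝ) : ℝ :=
  sSup {k' : ℝ | ∃ q : α → ℝ, IsDist q ∧ SD p q ≤ ε ∧ ∀ a, q a ≤ (2 : ℝ) ^ (-k')}

/-- Probability, over a uniformly random function `f : {0,1}^n → {0,1}^m`,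
that the predicate `P f` holds. -/
noncomputable def prF (n m : ℕ) (P : (BS n → BS m) → Prop) : ℝ :=
  ((Finset.univ.filter (fun f => P f)).card : ℝ) / (Fintype.card (BS n → BS m) : ℝ)

/-- Probability, over `X ∼ p`, of the event `A`. -/
noncomputable def prX {n : ℕ} (p : BS n → ℝ) (A : BS n → Prop) : ℝ :=
  ∑ x ∈ Finset.univ.filter (fun x => A x), p x

/-- The support of a mass function `p` on `{0,1}^n`. -/
noncomputable def supp {n : ℕ} (p : BS n → ℝ) : Finset (BS n) :=
  Finset.univ.filter (fun x => 0 < p x)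

/-- A mass function whose excess over `τ` has total mass at most `ε` is `ε`-close to a
distribution all of whose point masses are at most `τ`. -/
lemma exists_isDist_le_of_excess_le {α : Type*} [Fintype α] {P : α → ℝ} (hP : IsDist P)
    {τ ε : ℝ} (hτ : 0 ≤ τ) (hcard : 1 ≤ (Fintype.card α : ℝ) * τ)
    (hexc : ∑ a, max (P a - τ) 0 ≤ ε) :
    ∃ q : α → ℝ, IsDist q ∧ SD P q ≤ ε ∧ ∀ a, q a ≤ τ := by
  obtain ⟨hP0, hP1⟩ := hP
  set E := ∑ a, max (P a - τ) 0 with hE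
  set D := ∑ a, max (τ - P a) 0 with hD
  have hE0 : 0 ≤ E := Finset.sum_nonneg fun a _ => le_max_right _ _
  have hED : E ≤ D := by
    have h : D - E = (Fintype.card α : ℝ) * τ - 1 := by
      rw [hD, hE, ← Finset.sum_sub_distrib, ← hP1]
      have : ∀ a, max (τ - P a) 0 - max (P a - τ) 0 = τ - P a := by
        intro a
        rcases le_total τ (P a) with h | h
        · rw [max_eq_right (by linarith), max_eq_left (by linarith)]; ring
        · rw [max_eq_left (by linarith), max_eq_right (by linarith)]; ring
      simp [this, Finset.sum_sub_distrib]
    linarith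
  set ρ := E / D with hρ
  have hρ0 : 0 ≤ ρ := div_nonneg hE0 (hE0.trans hED)
  have hρ1 : ρ ≤ 1 := div_le_one_of_le₀ hED (hE0.trans hED)
  have hρD : ρ * D = E := by
    rcases eq_or_ne D 0 with h | h
    · rw [h, mul_zero]; linarith
    · rw [hρ, div_mul_cancel₀ _ h]
  have hmin : ∀ a, min (P a) τ = P a - max (P a - τ) 0 := by
    intro a
    rcases le_total τ (P a) with h | h
    · rw [min_eq_right h, max_eq_left (by linarith)]; ring
    · rw [min_eq_left h, max_eq_right (by linarith)]; ring
  refine ⟨fun a => min (P a) τ + ρ * max (τ - P a) 0, ⟨fun a => ?_, ?_⟩, ?_, fun a => ?_⟩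
  · exact add_nonneg (le_min (hP0 a) hτ) (mul_nonneg hρ0 (le_max_right _ _))
  · simp only [hmin]
    rw [Finset.sum_add_distrib, Finset.sum_sub_distrib, ← Finset.mul_sum, ← hD, ← hE, hρD, hP1]
    ring
  · have habs : ∀ a, |P a - (min (P a) τ + ρ * max (τ - P a) 0)|
        ≤ max (P a - τ) 0 + ρ * max (τ - P a) 0 := by
      intro a
      have h1 : 0 ≤ max (P a - τ) 0 := le_max_right _ _
      have h2 : 0 ≤ ρ * max (τ - P a) 0 := mul_nonneg hρ0 (le_max_right _ _)
      rw [hmin, abs_le]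
      constructor <;> linarith
    have hsum := Finset.sum_le_sum fun a (_ : a ∈ Finset.univ) => habs a
    rw [Finset.sum_add_distrib, ← Finset.mul_sum, ← hD, ← hE, hρD] at hsum
    unfold SD
    linarith
  · have h : ρ * max (τ - P a) 0 ≤ max (τ - P a) 0 :=
      mul_le_of_le_one_left (le_max_right _ _) hρ1
    change min (P a) τ + ρ * max (τ - P a) 0 ≤ τ
    rcases le_total τ (P a) with h' | h'
    · rw [max_eq_right (by linarith)] at h ⊢
      rw [min_eq_right h']; linarith
    · rw [max_eq_left (by linarith)] at h ⊢
      rw [min_eq_left h']; linarith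

lemma bddAbove_smoothMinEntropy {α : Type*} [Fintype α] (P : α → ℝ) (ε : ℝ) :
    BddAbove {k' : ℝ | ∃ q : α → ℝ, IsDist q ∧ SD P q ≤ ε ∧ ∀ a, q a ≤ (2 : ℝ) ^ (-k')} := by
  refine ⟨Real.logb 2 (Fintype.card α), ?_⟩
  rintro k' ⟨q, ⟨-, hq1⟩, -, hq⟩
  have h : 1 ≤ (Fintype.card α : ℝ) * (2 : ℝ) ^ (-k') := by
    calc (1 : ℝ) = ∑ a, q a := hq1.symm
      _ ≤ ∑ _a : α, (2 : ℝ) ^ (-k') := Finset.sum_le_sum fun a _ => hq a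
      _ = _ := by simp
  have hpos : (0 : ℝ) < 2 ^ k' := by positivity
  rw [Real.rpow_neg (by norm_num), ← div_eq_mul_inv, le_div_iff₀ hpos, one_mul] at h
  rwa [Real.le_logb_iff_rpow_le (by norm_num) (hpos.trans_le h)]

lemma isDist_pushforward {n m : ℕ} (f : BS n → BS m) {p : BS n → ℝ} (hp : IsDist p) :
    IsDist (pushforward f p) := by
  refine ⟨fun v => Finset.sum_nonneg fun x _ => hp.1 x, ?_⟩
  rw [← hp.2]
  exact Finset.sum_fiberwise _ _ _

/-- If the smooth min-entropy is below `κ`, then the excess mass above `2 ^ (-κ)` exceeds `ε`. -/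
lemma lt_excess_of_smoothMinEntropy_lt {α : Type*} [Fintype α] {P : α → ℝ} (hP : IsDist P)
    {κ ε : ℝ} (hcard : 1 ≤ (Fintype.card α : ℝ) * (2 : ℝ) ^ (-κ))
    (h : smoothMinEntropy P ε < κ) : ε < ∑ a, max (P a - (2 : ℝ) ^ (-κ)) 0 := by
  by_contra! hle
  obtain ⟨q, hq⟩ := exists_isDist_le_of_excess_le hP (by positivity) hcard hle
  exact h.not_ge (le_csSup (bddAbove_smoothMinEntropy P ε) ⟨q, hq⟩)

/-- If `φ` is convex along unit steps and `φ j ≤ 1 + c * a ^ j` at the natural numbers, then the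
bound extends to sums of weights in `[0, 1]`, with `a ^ j` replaced by its multi-affine
interpolation. -/
lemma le_one_add_mul_prod_of_le_natCast {ι : Type*} (w : ι → ℝ) (hw0 : ∀ i, 0 ≤ w i)
    (hw1 : ∀ i, w i ≤ 1) (a : ℝ) (A : Finset ι) (φ : ℝ → ℝ) (c : ℝ)
    (hφ : ∀ x u : ℝ, 0 ≤ u → u ≤ 1 → φ (u + x) ≤ (1 - u) * φ x + u * φ (1 + x))
    (hnat : ∀ j : ℕ, φ j ≤ 1 + c * a ^ j) :
    φ (∑ i ∈ A, w i) ≤ 1 + c * ∏ i ∈ A, (1 + (a - 1) * w i) := by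
  induction A using Finset.induction_on generalizing φ c with
  | empty => simpa using hnat 0
  | insert i A hi ih =>
    rw [Finset.sum_insert hi, Finset.prod_insert hi]
    have h1 := ih φ c hφ hnat
    have h2 := ih (fun x => φ (1 + x)) (c * a)
      (fun x u hu0 hu1 => by
        have := hφ (1 + x) u hu0 hu1
        rwa [add_left_comm u 1 x] at this)
      (fun j => by
        have := hnat (j + 1)
        push_cast at this
        rw [add_comm (1 : ℝ)]
        refine this.trans_eq ?_
        ring)
    have h3 := hφ (∑ i ∈ A, w i) (w i) (hw0 i) (hw1 i)
    have h4 := mul_le_mul_of_nonneg_left h1 (sub_nonneg.2 (hw1 i))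
    have h5 := mul_le_mul_of_nonneg_left h2 (hw0 i)
    refine (h3.trans (add_le_add h4 h5)).trans_eq ?_
    ring

lemma exp_mul_max_sub_unit_step {r : ℝ} (hr : 0 ≤ r) (L x u : ℝ) (hu0 : 0 ≤ u) (hu1 : u ≤ 1) :
    Real.exp (r * max (u + x - L) 0) ≤
      (1 - u) * Real.exp (r * max (x - L) 0) + u * Real.exp (r * max (1 + x - L) 0) := by
  have h1 : max (u + x - L) 0 ≤ (1 - u) * max (x - L) 0 + u * max (1 + x - L) 0 := by
    have hu : 0 ≤ 1 - u := sub_nonneg.2 hu1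
    refine max_le ?_ (by positivity)
    have := mul_le_mul_of_nonneg_left (le_max_left (x - L) 0) hu
    have := mul_le_mul_of_nonneg_left (le_max_left (1 + x - L) 0) hu0
    linarith
  have h2 := convexOn_exp.2 (Set.mem_univ (r * max (x - L) 0))
    (Set.mem_univ (r * max (1 + x - L) 0)) (sub_nonneg.2 hu1) hu0 (by ring)
  simp only [smul_eq_mul] at h2
  refine le_trans (Real.exp_le_exp.2 ?_) h2
  have := mul_le_mul_of_nonneg_left h1 hr
  linarith

lemma exp_mul_max_natCast_sub_le {r b L : ℝ} (hr : 0 ≤ r) (hrb : r ≤ b) {N : ℕ} (hN : (N : ℝ) ≤ L)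
    (j : ℕ) :
    Real.exp (r * max ((j : ℝ) - L) 0) ≤
      1 + Real.exp (r - b * (N + 1)) * Real.exp b ^ j := by
  rw [← Real.exp_nat_mul, ← Real.exp_add]
  rcases le_or_gt j N with h | h
  · have h' : (j : ℝ) ≤ N := by exact_mod_cast h
    rw [max_eq_right (by linarith), mul_zero, Real.exp_zero]
    linarith [Real.exp_pos (r - b * (N + 1) + j * b)]
  · have h' : (N : ℝ) + 1 ≤ j := by exact_mod_cast h
    have h1 : max ((j : ℝ) - L) 0 ≤ 1 + (j - N - 1) := max_le (by linarith) (by linarith)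
    have h2 := mul_le_mul_of_nonneg_left h1 hr
    have h3 := mul_le_mul_of_nonneg_right hrb (show (0 : ℝ) ≤ j - N - 1 by linarith)
    have h4 : Real.exp (r * max ((j : ℝ) - L) 0) ≤ Real.exp (r - b * (N + 1) + j * b) :=
      Real.exp_le_exp.2 (by linarith)
    linarith

/-- Averaging, over all functions `f`, a product over the fibres of `f`. -/
lemma sum_prod_one_add_fiber_le {α β : Type*} [Fintype α] [DecidableEq α] [Fintype β]
    [DecidableEq β] [Nonempty β]
    {y : α → ℝ} (hy : ∀ x, 0 ≤ y x) {c : ℝ} (hc : 0 ≤ c) :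
    ∑ f : α → β, ∏ v, (1 + c * ∏ x with f x = v, (1 + y x)) ≤
      (Fintype.card (α → β) : ℝ) *
        Real.exp (Fintype.card β * (c * Real.exp ((∑ x, y x) / Fintype.card β))) := by
  set M : ℝ := (Fintype.card β : ℝ) with hM
  have hM0 : 0 < M := by rw [hM]; exact_mod_cast Fintype.card_pos
  set d := Real.exp ((∑ x, y x) / M) with hd
  have hcount : ∀ S : Finset β, ∑ f : α → β, ∏ v ∈ S, ∏ x with f x = v, (1 + y x) ≤
      (Fintype.card (α → β) : ℝ) * d ^ S.card := by
    intro S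
    have h1 : ∀ f : α → β, ∏ v ∈ S, ∏ x with f x = v, (1 + y x) =
        ∏ x, if f x ∈ S then 1 + y x else 1 := by
      intro f
      simp only [Finset.prod_filter]
      rw [Finset.prod_comm]
      refine Finset.prod_congr rfl fun x _ => ?_
      rw [Finset.prod_ite_eq]
    have h2 : ∀ x, (∑ v : β, if v ∈ S then 1 + y x else 1) ≤
        M * Real.exp (S.card * (y x / M)) := by
      intro x
      have h3 : ∀ v : β, (if v ∈ S then 1 + y x else 1) = 1 + if v ∈ S then y x else 0 := by
        intro v; split_ifs <;> simp
      simp only [h3, Finset.sum_add_distrib, Finset.sum_ite_mem, Finset.univ_inter,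
        Finset.sum_const, Finset.card_univ, nsmul_eq_mul, mul_one, ← hM]
      have h4 := mul_le_mul_of_nonneg_left (Real.add_one_le_exp (S.card * (y x / M))) hM0.le
      refine le_trans (le_of_eq ?_) h4
      field_simp
      ring
    calc ∑ f : α → β, ∏ v ∈ S, ∏ x with f x = v, (1 + y x)
        = ∑ f : α → β, ∏ x, (if f x ∈ S then 1 + y x else 1) :=
          Finset.sum_congr rfl fun f _ => h1 f
      _ = ∏ x, ∑ v : β, (if v ∈ S then 1 + y x else 1) :=
          (Fintype.prod_sum fun x v => if v ∈ S then 1 + y x else 1).symm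
      _ ≤ ∏ x, (M * Real.exp (S.card * (y x / M))) := by
          refine Finset.prod_le_prod (fun x _ => Finset.sum_nonneg fun v _ => ?_) fun x _ => h2 x
          have := hy x
          split_ifs <;> linarith
      _ = (Fintype.card (α → β) : ℝ) * d ^ S.card := by
          rw [Finset.prod_mul_distrib, ← Real.exp_sum, ← Finset.mul_sum, ← Finset.sum_div,
            Real.exp_nat_mul]
          simp [hM, hd]
  have hexpand : ∀ f : α → β, ∏ v, (1 + c * ∏ x with f x = v, (1 + y x)) =
      ∑ S : Finset β, c ^ S.card * ∏ v ∈ S, ∏ x with f x = v, (1 + y x) := by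
    intro f
    rw [Finset.prod_one_add, Finset.powerset_univ]
    refine Finset.sum_congr rfl fun S _ => ?_
    rw [Finset.prod_mul_distrib, Finset.prod_const]
  calc ∑ f : α → β, ∏ v, (1 + c * ∏ x with f x = v, (1 + y x))
      = ∑ S : Finset β, c ^ S.card * ∑ f : α → β, ∏ v ∈ S, ∏ x with f x = v, (1 + y x) := by
        simp only [hexpand, Finset.mul_sum]
        rw [Finset.sum_comm]
    _ ≤ ∑ S : Finset β, c ^ S.card * ((Fintype.card (α → β) : ℝ) * d ^ S.card) :=
        Finset.sum_le_sum fun S _ => mul_le_mul_of_nonneg_left (hcount S) (by positivity)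
    _ = (Fintype.card (α → β) : ℝ) * (1 + c * d) ^ Fintype.card β := by
        have : ∏ _v : β, (1 + c * d) = ∑ S : Finset β, (c * d) ^ S.card := by
          rw [Finset.prod_one_add, Finset.powerset_univ]
          simp
        rw [← Finset.card_univ (α := β), ← Finset.prod_const, this, Finset.mul_sum]
        refine Finset.sum_congr rfl fun S _ => ?_
        rw [mul_pow]; ring
    _ ≤ (Fintype.card (α → β) : ℝ) * Real.exp (M * (c * d)) := by
        refine mul_le_mul_of_nonneg_left ?_ (Nat.cast_nonneg _)
        rw [hM, Real.exp_nat_mul]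
        refine pow_le_pow_left₀ (by positivity) ?_ _
        linarith [Real.add_one_le_exp (c * d)]

/-- Exponential-moment bound on the total excess load when items of weight at most `1` are thrown
into bins by a uniformly random function. -/
lemma sum_exp_excess_le {α β : Type*} [Fintype α] [DecidableEq α] [Fintype β]
    [DecidableEq β] [Nonempty β]
    {w : α → ℝ} (hw0 : ∀ x, 0 ≤ w x) (hw1 : ∀ x, w x ≤ 1) {r b L : ℝ} (hr : 0 ≤ r) (hrb : r ≤ b)
    {N : ℕ} (hN : (N : ℝ) ≤ L) :
    ∑ f : α → β, Real.exp (r * ∑ v, max ((∑ x with f x = v, w x) - L) 0) ≤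
      (Fintype.card (α → β) : ℝ) * Real.exp (Fintype.card β * (Real.exp (r - b * (N + 1)) *
        Real.exp ((Real.exp b - 1) * (∑ x, w x) / Fintype.card β))) := by
  have hb : 0 ≤ Real.exp b - 1 := sub_nonneg.2 (Real.one_le_exp (hr.trans hrb))
  rw [Finset.mul_sum]
  refine le_trans (Finset.sum_le_sum fun f _ => ?_)
    (sum_prod_one_add_fiber_le (fun x => mul_nonneg hb (hw0 x)) (Real.exp_pos _).le)
  rw [Finset.mul_sum, Real.exp_sum]
  refine Finset.prod_le_prod (fun v _ => (Real.exp_pos _).le) fun v _ => ?_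
  exact le_one_add_mul_prod_of_le_natCast w hw0 hw1 (Real.exp b) _
    (fun s => Real.exp (r * max (s - L) 0)) _
    (fun x u hu0 hu1 => exp_mul_max_sub_unit_step hr L x u hu0 hu1)
    (fun j => exp_mul_max_natCast_sub_le hr hrb hN j)

lemma prF_le_one (n m : ℕ) (P : (BS n → BS m) → Prop) : prF n m P ≤ 1 := by
  refine div_le_one_of_le₀ ?_ (Nat.cast_nonneg _)
  exact_mod_cast Finset.card_le_univ _

/-- Markov's inequality for the exponential moment of a statistic of a random function. -/
lemma prF_le_exp_of_sum_exp_le {n m : ℕ} {P : (BS n → BS m) → Prop} {F : (BS n → BS m) → ℝ}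
    {θ B : ℝ} (hP : ∀ f, P f → θ ≤ F f)
    (hF : ∑ f, Real.exp (F f) ≤ (Fintype.card (BS n → BS m) : ℝ) * Real.exp B) :
    prF n m P ≤ Real.exp (B - θ) := by
  have hcard : (0 : ℝ) < Fintype.card (BS n → BS m) := by exact_mod_cast Fintype.card_pos
  unfold prF
  rw [div_le_iff₀ hcard, Real.exp_sub, div_mul_eq_mul_div, le_div_iff₀ (Real.exp_pos _),
    mul_comm (Real.exp B)]
  refine le_trans ?_ hF
  calc ((Finset.univ.filter fun f => P f).card : ℝ) * Real.exp θ
      = ∑ _f ∈ Finset.univ.filter (fun f => P f), Real.exp θ := by simp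
    _ ≤ ∑ f ∈ Finset.univ.filter (fun f => P f), Real.exp (F f) :=
        Finset.sum_le_sum fun f hf => Real.exp_le_exp.2 (hP f (Finset.mem_filter.1 hf).2)
    _ ≤ ∑ f, Real.exp (F f) :=
        Finset.sum_le_sum_of_subset_of_nonneg (Finset.filter_subset _ _)
          fun f _ _ => (Real.exp_pos _).le

/-- The total weight of overfull bins, in the regime where the gap exceeds
`16 + log₂ (1 / ε) / N` by `Δ`. -/
lemma two_rpow_gap_mul_exp_le {K L g ε Δ : ℝ} {N : ℕ} (hK : 0 < K) (hL : 1 ≤ L) (hN : 1 ≤ N)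
    (hLN : L ≤ N + 1) (hε : 0 < ε) (hΔ0 : 0 ≤ Δ)
    (hΔ : Δ = g - (1 / (N : ℝ)) * Real.logb 2 (1 / ε) - 16) :
    (2 : ℝ) ^ g * K / L * ((2 : ℝ) ^ (Δ + 1 - g * (N + 1)) * Real.exp L) ≤ ε * K / 2 := by
  have hN1 : (1 : ℝ) ≤ N := by exact_mod_cast hN
  have hexp : Real.exp L ≤ (2 : ℝ) ^ (3 * (N : ℝ)) := by
    have h8 : Real.exp 2 ≤ 8 := by
      have h := Real.exp_one_lt_d9
      have h2 : Real.exp 2 = Real.exp 1 * Real.exp 1 := by rw [← Real.exp_add]; norm_num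
      rw [h2]
      nlinarith [Real.exp_pos 1]
    calc Real.exp L ≤ Real.exp (2 * N) := Real.exp_le_exp.2 (by linarith)
      _ = Real.exp 2 ^ (N : ℝ) := by rw [Real.exp_mul]
      _ ≤ (8 : ℝ) ^ (N : ℝ) := Real.rpow_le_rpow (Real.exp_pos _).le h8 (by linarith)
      _ = (2 : ℝ) ^ (3 * (N : ℝ)) := by
        rw [Real.rpow_mul (by norm_num)]; norm_num
  have hgN : g * N = Δ * N - Real.logb 2 ε + 16 * N := by
    rw [hΔ, one_div ε, Real.logb_inv]
    field_simp
    ring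
  have hpow : (2 : ℝ) ^ g * ((2 : ℝ) ^ (Δ + 1 - g * (N + 1)) * (2 : ℝ) ^ (3 * (N : ℝ))) ≤
      ε / 2 := by
    rw [← Real.rpow_add (by norm_num), ← Real.rpow_add (by norm_num)]
    calc (2 : ℝ) ^ (g + (Δ + 1 - g * (N + 1) + 3 * N)) ≤ (2 : ℝ) ^ (Real.logb 2 ε - 1) := by
          refine Real.rpow_le_rpow_of_exponent_le (by norm_num) ?_
          nlinarith
      _ = ε / 2 := by
          rw [Real.rpow_sub_one (by norm_num), Real.rpow_logb (by norm_num) (by norm_num) hε]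
  calc (2 : ℝ) ^ g * K / L * ((2 : ℝ) ^ (Δ + 1 - g * (N + 1)) * Real.exp L)
      ≤ (2 : ℝ) ^ g * K * ((2 : ℝ) ^ (Δ + 1 - g * (N + 1)) * (2 : ℝ) ^ (3 * (N : ℝ))) := by
        gcongr
        exact div_le_self (by positivity) hL
    _ = K * ((2 : ℝ) ^ g * ((2 : ℝ) ^ (Δ + 1 - g * (N + 1)) * (2 : ℝ) ^ (3 * (N : ℝ)))) := by
        ring
    _ ≤ K * (ε / 2) := mul_le_mul_of_nonneg_left hpow hK.le
    _ = ε * K / 2 := by ring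

/-- a random function is a condenser, condenser (large gap) regime. -/
theorem stmt7 (n m : ℕ) (k ℓ g ε : ℝ) (p : BS n → ℝ)
    (hp : IsDist p) (hk : ∀ x, p x ≤ (2 : ℝ) ^ (-k))
    (hℓ0 : 0 ≤ ℓ) (hℓk : ℓ ≤ k) (hg : 0 < g) (hm : (m : ℝ) = k - ℓ + g)
    (hε0 : 0 < ε) (hε1 : ε ≤ 1) :
    prF n m (fun f => smoothMinEntropy (pushforward f p) ε < k - ℓ) ≤
      4 * (2 : ℝ) ^ (-(ε * (2 : ℝ) ^ k / 6) *
        (g - (1 / (⌊(2 : ℝ) ^ ℓ⌋ : ℝ)) * Real.logb 2 (1 / ε) - 16)) := by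
  set K : ℝ := (2 : ℝ) ^ k with hKdef
  set L : ℝ := (2 : ℝ) ^ ℓ with hLdef
  have hK : 0 < K := by positivity
  have hL : 1 ≤ L := Real.one_le_rpow (by norm_num) hℓ0
  have hL0 : 0 < L := by linarith
  obtain ⟨N, hN⟩ : ∃ N : ℕ, N = ⌊L⌋₊ := ⟨_, rfl⟩
  have hNL : (N : ℝ) ≤ L := hN ▸ Nat.floor_le hL0.le
  have hLN : L ≤ N + 1 := hN ▸ (Nat.lt_floor_add_one L).le
  have hN1 : 1 ≤ N := hN ▸ (Nat.one_le_floor_iff L).2 hL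
  rw [← natCast_floor_eq_intCast_floor hL0.le, ← hN]
  obtain ⟨Δ, hΔ⟩ : ∃ Δ, Δ = g - (1 / (N : ℝ)) * Real.logb 2 (1 / ε) - 16 := ⟨_, rfl⟩
  rw [← hΔ]
  have hεK : 0 < ε * K := mul_pos hε0 hK
  rcases le_or_gt Δ 0 with hneg | hpos
  · refine (prF_le_one _ _ _).trans ?_
    have : (1 : ℝ) ≤ (2 : ℝ) ^ (-(ε * K / 6) * Δ) :=
      Real.one_le_rpow (by norm_num) (by nlinarith)
    linarith
  have hlog : 0 ≤ Real.logb 2 (1 / ε) :=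
    Real.logb_nonneg (by norm_num) (by rw [one_div]; exact (one_le_inv₀ hε0).2 hε1)
  have hΔg : Δ + 1 ≤ g := by
    have : 0 ≤ 1 / (N : ℝ) * Real.logb 2 (1 / ε) := mul_nonneg (by positivity) hlog
    linarith
  have hcard : (Fintype.card (BS m) : ℝ) = (2 : ℝ) ^ g * K / L := by
    rw [hKdef, hLdef, ← Real.rpow_add (by norm_num), ← Real.rpow_sub (by norm_num),
      show g + k - ℓ = (m : ℝ) by linarith, Real.rpow_natCast]
    simp
  have hτ : (2 : ℝ) ^ (-(k - ℓ)) = L / K := by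
    rw [hKdef, hLdef, ← Real.rpow_sub (by norm_num)]; congr 1; ring
  have hlog2 : 0 < Real.log 2 := Real.log_pos (by norm_num)
  have hexp2 : ∀ x : ℝ, Real.exp (x * Real.log 2) = (2 : ℝ) ^ x := fun x => by
    rw [Real.rpow_def_of_pos (by norm_num), mul_comm]
  have hw1 : ∀ x, K * p x ≤ 1 := fun x => by
    have h := mul_le_mul_of_nonneg_left (hk x) hK.le
    rwa [hKdef, ← Real.rpow_add (by norm_num), add_neg_cancel, Real.rpow_zero] at h
  have hmoment := sum_exp_excess_le (β := BS m) (fun x => mul_nonneg hK.le (hp.1 x)) hw1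
    (r := (Δ + 1) * Real.log 2) (b := g * Real.log 2) (by positivity)
    (mul_le_mul_of_nonneg_right hΔg hlog2.le) hNL
  have hbad : ∀ f : BS n → BS m, smoothMinEntropy (pushforward f p) ε < k - ℓ →
      (Δ + 1) * Real.log 2 * (ε * K) ≤
        (Δ + 1) * Real.log 2 * ∑ v, max ((∑ x with f x = v, K * p x) - L) 0 := by
    intro f hf
    refine mul_le_mul_of_nonneg_left ?_ (by positivity)
    have h := lt_excess_of_smoothMinEntropy_lt (isDist_pushforward f hp) (by
      rw [hcard, hτ]
      have : (1 : ℝ) ≤ 2 ^ g := Real.one_le_rpow (by norm_num) hg.le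
      refine this.trans_eq ?_
      field_simp) hf
    rw [hτ] at h
    have h' := mul_le_mul_of_nonneg_right h.le hK.le
    refine h'.trans_eq ?_
    rw [Finset.sum_mul]
    refine Finset.sum_congr rfl fun v _ => ?_
    rw [max_mul_of_nonneg _ _ hK.le, zero_mul, sub_mul, div_mul_cancel₀ _ hK.ne', ← Finset.mul_sum,
      mul_comm, pushforward]
  refine (prF_le_exp_of_sum_exp_le hbad hmoment).trans ?_
  have hB : (Fintype.card (BS m) : ℝ) * (Real.exp ((Δ + 1) * Real.log 2 - g * Real.log 2 * (N + 1)) *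
      Real.exp ((Real.exp (g * Real.log 2) - 1) * (∑ x, K * p x) / Fintype.card (BS m))) ≤
      ε * K / 2 := by
    refine le_trans ?_ (two_rpow_gap_mul_exp_le hK hL hN1 hLN hε0 hpos.le hΔ)
    rw [hexp2, ← Finset.mul_sum, hp.2, hcard,
      show (Δ + 1) * Real.log 2 - g * Real.log 2 * (N + 1) = (Δ + 1 - g * (N + 1)) * Real.log 2 by
        ring, hexp2]
    gcongr
    rw [div_le_iff₀ (by positivity)]
    have : L * ((2 : ℝ) ^ g * K / L) = (2 : ℝ) ^ g * K := by field_simp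
    rw [this, mul_one]
    nlinarith
  have hfinal : Real.exp ((Fintype.card (BS m) : ℝ) *
      (Real.exp ((Δ + 1) * Real.log 2 - g * Real.log 2 * (N + 1)) *
        Real.exp ((Real.exp (g * Real.log 2) - 1) * (∑ x, K * p x) / Fintype.card (BS m))) -
      (Δ + 1) * Real.log 2 * (ε * K)) ≤ (2 : ℝ) ^ (-(ε * K / 6) * Δ) := by
    rw [← hexp2]
    refine Real.exp_le_exp.2 ?_
    have hhalf : ε * K / 2 ≤ Real.log 2 * (ε * K) := by
      nlinarith [Real.log_two_gt_d9]
    have hpos' : 0 ≤ Δ * Real.log 2 * (ε * K) := by positivity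
    linarith
  refine hfinal.trans ?_
  have : (0 : ℝ) ≤ (2 : ℝ) ^ (-(ε * K / 6) * Δ) := by positivity
  linarith
end

section
/- Let X be an (n,k)-source. For any real ℓ ∈ [0,k] and real g ≥ 0 such that m := k − ℓ + g is a (nonnegative) integer, and any ε ∈ (0,1], the following holds, where k′ := k − ℓ, K := 2^k, K′ := 2^{k′}, L := 2^ℓ, N := 2^n. Suppose the support of X is partitioned into sets X₁ and X₂, where X₁ consists of the min{⌈4KL⌉, N} highest-probability elements of support(X) (ties broken arbitrarily) and X₂ is the rest. If f : {0,1}^n → {0,1}^m is a uniformly random function, then Pr_f[ ∃ S ⊆ {0,1}^m : (Pr_X[f(X) = v and X ∈ X₁] > ((L−1)/L)·(1/K′) for all v ∈ S) and Pr_X[f(X) ∈ S and X ∈ X₂] > ε ] ≤ 2 · 2^{−(εK/2)·( g − (1/⌊L⌋)·log₂(1/ε) − 11 )}. -/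
open Finset Real
open scoped Classical

section RandomFunction

variable {α β : Type*} [Fintype α] [DecidableEq α] [Fintype β] [DecidableEq β]

/-- Expectation bound for a random function: the factors `1 + c x`, present when `f x ∈ S`,
are independent. -/
lemma sum_prod_filter_mem_le [Nonempty β] (A : Finset α) (S : Finset β) (c : α → ℝ)
    (hc : ∀ x ∈ A, 0 ≤ c x) :
    ∑ f : α → β, ∏ x ∈ A with f x ∈ S, (1 + c x) ≤
      (Fintype.card (α → β) : ℝ) *
        Real.exp ((∑ x ∈ A, c x) * ((#S : ℝ) / (Fintype.card β : ℝ))) := by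
  have hβ : (0 : ℝ) < Fintype.card β := by exact_mod_cast Fintype.card_pos
  have hprod : ∀ f : α → β, ∏ x ∈ A with f x ∈ S, (1 + c x) =
      ∏ x, (1 + if x ∈ A then (if f x ∈ S then c x else 0) else 0) := by
    intro f
    rw [Finset.prod_filter, ← Finset.prod_subset (Finset.subset_univ A)]
    · refine Finset.prod_congr rfl fun x hx => ?_
      by_cases h : f x ∈ S <;> simp [hx, h]
    · intro x _ hx
      simp [hx]
  simp_rw [hprod]
  rw [← Fintype.prod_sum fun (x : α) (v : β) =>
    (1 : ℝ) + if x ∈ A then (if v ∈ S then c x else 0) else 0]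
  have hcard : (Fintype.card (α → β) : ℝ) = ∏ _x : α, (Fintype.card β : ℝ) := by
    simp
  have hexp : Real.exp ((∑ x ∈ A, c x) * ((#S : ℝ) / (Fintype.card β : ℝ))) =
      ∏ x, Real.exp ((if x ∈ A then c x else 0) * ((#S : ℝ) / (Fintype.card β : ℝ))) := by
    rw [← Real.exp_sum, ← Finset.sum_mul]
    simp
  rw [hcard, hexp, ← Finset.prod_mul_distrib]
  refine Finset.prod_le_prod (fun x _ => Finset.sum_nonneg fun v _ => ?_) fun x _ => ?_
  · by_cases hx : x ∈ A
    · have := hc x hx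
      simp only [hx, if_true]
      split_ifs <;> linarith
    · simp [hx]
  · by_cases hx : x ∈ A
    · have hsum : ∑ v : β, ((1 : ℝ) + if x ∈ A then (if v ∈ S then c x else 0) else 0) =
          Fintype.card β * (c x * ((#S : ℝ) / Fintype.card β) + 1) := by
        simp only [hx, if_true, Finset.sum_add_distrib, Finset.sum_ite_mem, Finset.univ_inter,
          Finset.sum_const, Finset.card_univ, nsmul_eq_mul]
        field_simp
        ring
      rw [hsum]
      simp only [hx, if_true]
      exact mul_le_mul_of_nonneg_left (Real.add_one_le_exp _) hβ.le
    · simp [hx]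

/-- Markov's inequality for the counting measure. -/
lemma card_filter_mul_le_sum {ι : Type*} [Fintype ι] (P : ι → Prop) [DecidablePred P]
    (h : ι → ℝ) (b : ℝ) (h0 : ∀ i, 0 ≤ h i) (hb : ∀ i, P i → b ≤ h i) :
    (#{i | P i} : ℝ) * b ≤ ∑ i, h i := by
  calc (#{i | P i} : ℝ) * b = ∑ i with P i, b := by simp
    _ ≤ ∑ i with P i, h i := Finset.sum_le_sum fun i hi => hb i (by simpa using hi)
    _ ≤ ∑ i, h i := Finset.sum_le_sum_of_subset_of_nonneg (Finset.subset_univ _) fun i _ _ => h0 i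

/-- Tail bound for the number of values `v` whose fibre has a large product weight. -/
lemma card_filter_le_card_mul_rpow_le [Nonempty β] (A : Finset α) (c : α → ℝ)
    (hc : ∀ x ∈ A, 0 ≤ c x) {B r s : ℝ} (hB : 0 ≤ B) (hr : 0 ≤ r)
    (T : (α → β) → Finset β)
    (hT : ∀ f, ∀ v ∈ T f, B ≤ ∏ x ∈ A with f x = v, (1 + c x)) :
    (#{f : α → β | s ≤ #(T f)} : ℝ) * (1 + r * B) ^ s ≤
      (Fintype.card (α → β) : ℝ) *
        Real.exp (r * Real.exp ((∑ x ∈ A, c x) / Fintype.card β) * Fintype.card β) := by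
  have hprod0 : ∀ (f : α → β) (S : Finset β), 0 ≤ ∏ x ∈ A with f x ∈ S, (1 + c x) :=
    fun f S => Finset.prod_nonneg fun x hx => by
      have := hc x (Finset.mem_of_mem_filter x hx)
      linarith
  have hrB : 0 ≤ r * B := mul_nonneg hr hB
  set E := Real.exp ((∑ x ∈ A, c x) / Fintype.card β) with hE
  calc (#{f : α → β | s ≤ #(T f)} : ℝ) * (1 + r * B) ^ s
      ≤ ∑ f : α → β, ∑ S : Finset β, r ^ #S * ∏ x ∈ A with f x ∈ S, (1 + c x) := by
        refine card_filter_mul_le_sum _ _ _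
          (fun f => Finset.sum_nonneg fun S _ => mul_nonneg (pow_nonneg hr _) (hprod0 f S)) ?_
        intro f hf
        calc (1 + r * B) ^ s ≤ (1 + r * B) ^ ((#(T f) : ℕ) : ℝ) :=
              Real.rpow_le_rpow_of_exponent_le (by linarith) hf
          _ = ∑ S ∈ (T f).powerset, (r * B) ^ #S := by
              rw [Real.rpow_natCast, add_comm, ← Finset.sum_pow_mul_eq_add_pow]
              simp
          _ ≤ ∑ S ∈ (T f).powerset, r ^ #S * ∏ x ∈ A with f x ∈ S, (1 + c x) := by
              refine Finset.sum_le_sum fun S hS => ?_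
              rw [Finset.mem_powerset] at hS
              rw [mul_pow]
              refine mul_le_mul_of_nonneg_left ?_ (pow_nonneg hr _)
              rw [← Finset.prod_fiberwise_of_maps_to (s := {x ∈ A | f x ∈ S}) (t := S) (g := f)
                (fun x hx => (Finset.mem_filter.mp hx).2), ← Finset.prod_const]
              refine Finset.prod_le_prod (fun _ _ => hB) fun v hv => ?_
              have hfil : {x ∈ {x ∈ A | f x ∈ S} | f x = v} = {x ∈ A | f x = v} := by
                ext x
                simp only [Finset.mem_filter]
                constructor
                · rintro ⟨⟨h1, _⟩, h3⟩
                  exact ⟨h1, h3⟩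
                · rintro ⟨h1, h3⟩
                  exact ⟨⟨h1, h3 ▸ hv⟩, h3⟩
              rw [hfil]
              exact hT f v (hS hv)
          _ ≤ _ := Finset.sum_le_sum_of_subset_of_nonneg (Finset.subset_univ _) fun S _ _ =>
              mul_nonneg (pow_nonneg hr _) (hprod0 f S)
    _ = ∑ S : Finset β, r ^ #S * ∑ f : α → β, ∏ x ∈ A with f x ∈ S, (1 + c x) := by
        rw [Finset.sum_comm]
        simp_rw [Finset.mul_sum]
    _ ≤ ∑ S : Finset β, r ^ #S * ((Fintype.card (α → β) : ℝ) * E ^ #S) := by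
        refine Finset.sum_le_sum fun S _ => mul_le_mul_of_nonneg_left ?_ (pow_nonneg hr _)
        refine (sum_prod_filter_mem_le A S c hc).trans_eq ?_
        rw [hE, ← Real.exp_nat_mul]
        congr 2
        ring
    _ = (Fintype.card (α → β) : ℝ) * (r * E + 1) ^ Fintype.card β := by
        rw [← Fintype.sum_pow_mul_eq_add_pow, Finset.mul_sum]
        refine Finset.sum_congr rfl fun S _ => ?_
        rw [mul_pow, one_pow]
        ring
    _ ≤ _ := by
        refine mul_le_mul_of_nonneg_left ?_ (Nat.cast_nonneg _)
        rw [mul_comm (r * E), Real.exp_nat_mul]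
        exact pow_le_pow_left₀ (by positivity) (Real.add_one_le_exp _) _

/-- Chernoff bound for the weight mapped into a fixed set by a random function. -/
lemma card_filter_lt_sum_mul_le [Nonempty β] (A : Finset α) (S : Finset β) (p : α → ℝ)
    {R ε q φ : ℝ} (hR : 0 ≤ R) (hφ : 0 ≤ φ) (hq : (#S : ℝ) ≤ q * Fintype.card β)
    (hp0 : ∀ x ∈ A, 0 ≤ p x) (hp1 : ∀ x ∈ A, R * p x ≤ 1) (hpsum : ∑ x ∈ A, p x ≤ 1) :
    (#{f : α → β | ε < ∑ x ∈ A with f x ∈ S, p x} : ℝ) * (1 + φ) ^ (R * ε) ≤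
      (Fintype.card (α → β) : ℝ) * Real.exp (φ * R * q) := by
  have hβ : (0 : ℝ) < Fintype.card β := by exact_mod_cast Fintype.card_pos
  have hc : ∀ x ∈ A, 0 ≤ φ * (R * p x) := fun x hx =>
    mul_nonneg hφ (mul_nonneg hR (hp0 x hx))
  have hq' : (#S : ℝ) / Fintype.card β ≤ q := (div_le_iff₀ hβ).mpr hq
  have hmarkov := card_filter_mul_le_sum (fun f : α → β => ε < ∑ x ∈ A with f x ∈ S, p x)
    (fun f => ∏ x ∈ A with f x ∈ S, (1 + φ * (R * p x))) ((1 + φ) ^ (R * ε))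
    (fun f => Finset.prod_nonneg fun x hx => ?_) fun f hf => ?_
  · refine hmarkov.trans ((sum_prod_filter_mem_le A S _ hc).trans ?_)
    refine mul_le_mul_of_nonneg_left (Real.exp_le_exp.mpr ?_) (Nat.cast_nonneg _)
    rw [← Finset.mul_sum, ← Finset.mul_sum]
    have h0 : (0 : ℝ) ≤ (#S : ℝ) / Fintype.card β := by positivity
    have hφR : 0 ≤ φ * R := mul_nonneg hφ hR
    have hs0 : 0 ≤ ∑ x ∈ A, p x := Finset.sum_nonneg hp0
    calc φ * (R * ∑ x ∈ A, p x) * ((#S : ℝ) / Fintype.card β)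
        ≤ φ * (R * 1) * q := by gcongr
      _ = φ * R * q := by ring
  · have := hc x (Finset.mem_of_mem_filter x hx)
    linarith
  · calc (1 + φ) ^ (R * ε) ≤ (1 + φ) ^ (∑ x ∈ A with f x ∈ S, R * p x) := by
          rw [← Finset.mul_sum]
          exact Real.rpow_le_rpow_of_exponent_le (by linarith)
            (mul_le_mul_of_nonneg_left hf.le hR)
      _ = ∏ x ∈ A with f x ∈ S, (1 + φ) ^ (R * p x) :=
          Real.rpow_sum_of_pos (by linarith) _ _
      _ ≤ _ := by
          refine Finset.prod_le_prod (fun x _ => Real.rpow_nonneg (by linarith) _) fun x hx => ?_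
          have hxA := Finset.mem_of_mem_filter x hx
          rw [mul_comm φ]
          exact rpow_one_add_le_one_add_mul_self (by linarith)
            (mul_nonneg hR (hp0 x hxA)) (hp1 x hxA)

/-- The Chernoff bound for a target set that is determined by the values of `f` on a set of
inputs disjoint from the inputs that carry the weight. -/
lemma card_filter_lt_sum_mem_dep_mul_le [Nonempty β] (A A' : Finset α) (hAA' : Disjoint A A')
    (T : (α → β) → Finset β) (hT : ∀ f f' : α → β, (∀ x ∈ A, f x = f' x) → T f = T f')
    (p : α → ℝ) {R ε q φ : ℝ} (hR : 0 ≤ R) (hφ : 0 ≤ φ)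
    (hp0 : ∀ x ∈ A', 0 ≤ p x) (hp1 : ∀ x ∈ A', R * p x ≤ 1) (hpsum : ∑ x ∈ A', p x ≤ 1) :
    (#{f : α → β | (#(T f) : ℝ) < q * Fintype.card β ∧ ε < ∑ x ∈ A' with f x ∈ T f, p x} : ℝ) *
        (1 + φ) ^ (R * ε) ≤
      (Fintype.card (α → β) : ℝ) * Real.exp (φ * R * q) := by
  let e := Equiv.piEquivPiSubtypeProd (fun x => x ∈ A) (fun _ => β)
  have hmem : ∀ x ∈ A', x ∉ A := fun x hx hxA => Finset.disjoint_left.mp hAA' hxA hx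
  have hcard : (Fintype.card (α → β) : ℝ) =
      ∑ _f₁ : {x // x ∈ A} → β, (Fintype.card ({x // x ∉ A} → β) : ℝ) := by
    rw [Fintype.card_congr e, Fintype.card_prod]
    simp
  rw [Finset.card_filter, ← e.symm.sum_comp, Fintype.sum_prod_type, hcard, Nat.cast_sum,
    Finset.sum_mul, Finset.sum_mul]
  refine Finset.sum_le_sum fun f₁ _ => ?_
  rw [← Finset.card_filter]
  obtain ⟨f₀⟩ : Nonempty ({x // x ∉ A} → β) := inferInstance
  have hTeq : ∀ f₂, T (e.symm (f₁, f₂)) = T (e.symm (f₁, f₀)) := fun f₂ =>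
    hT _ _ fun x hx => by simp [e, Equiv.piEquivPiSubtypeProd, hx]
  simp_rw [hTeq]
  set S := T (e.symm (f₁, f₀))
  have hsub : ∀ f₂ : {x // x ∉ A} → β, ∑ x ∈ A' with e.symm (f₁, f₂) x ∈ S, p x =
      ∑ x ∈ A'.subtype (· ∉ A) with f₂ x ∈ S, p x := by
    intro f₂
    rw [Finset.sum_filter, Finset.sum_filter, ← Finset.sum_subtype_of_mem _ hmem]
    refine Finset.sum_congr rfl fun x _ => ?_
    simp [e, Equiv.piEquivPiSubtypeProd, x.2]
  simp_rw [hsub]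
  by_cases hS : (#S : ℝ) < q * Fintype.card β
  · simp only [hS, true_and]
    refine card_filter_lt_sum_mul_le (A'.subtype (· ∉ A)) S (fun x => p x) hR hφ hS.le
      (fun x hx => hp0 x (by simpa using hx)) (fun x hx => hp1 x (by simpa using hx)) ?_
    rwa [Finset.sum_subtype_of_mem _ hmem]
  · simp only [hS, false_and, Finset.filter_false, Finset.card_empty, Nat.cast_zero, zero_mul]
    positivity

end RandomFunction

/-- If weights in `[0, 1]` have total more than `t - 1`, then there are essentially `t` factors
of order `θ` in the product of the `1 + θ (w x + η)`. -/
lemma pow_mul_le_prod_one_add {α : Type*} [DecidableEq α] (F : Finset α) (w : α → ℝ) {θ η : ℝ}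
    (t : ℕ) (hθ : 0 ≤ θ) (hη : 0 ≤ η) (hη2 : η ≤ 1 / 2)
    (hw0 : ∀ x ∈ F, 0 ≤ w x) (hw1 : ∀ x ∈ F, w x ≤ 1) (hsum : (t : ℝ) < ∑ x ∈ F, w x) :
    (1 + θ / 2) ^ t * (1 + θ * η) ≤ ∏ x ∈ F, (1 + θ * (w x + η)) := by
  have hηle : 1 + θ * η ≤ 1 + θ / 2 := by nlinarith
  have hbase : (1 : ℝ) ≤ 1 + θ / 2 := by linarith
  have hone : ∀ x ∈ F, 1 ≤ 1 + θ * (w x + η) := fun x hx => by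
    have := mul_nonneg hθ (add_nonneg (hw0 x hx) hη)
    linarith
  set H := {x ∈ F | 1 / 2 ≤ w x} with hH
  set J := {x ∈ F | ¬ 1 / 2 ≤ w x} with hJ
  have hHF : H ⊆ F := Finset.filter_subset _ _
  have hJF : J ⊆ F := Finset.filter_subset _ _
  have hprodH : (1 + θ / 2) ^ #H ≤ ∏ x ∈ H, (1 + θ * (w x + η)) := by
    rw [← Finset.prod_const]
    refine Finset.prod_le_prod (fun _ _ => by linarith) fun x hx => ?_
    have := (Finset.mem_filter.mp hx).2
    nlinarith
  have hprodJ1 : 1 ≤ ∏ x ∈ J, (1 + θ * (w x + η)) :=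
    Finset.one_le_prod fun x hx => hone x (hJF hx)
  have hsplit : (∏ x ∈ H, (1 + θ * (w x + η))) * ∏ x ∈ J, (1 + θ * (w x + η)) =
      ∏ x ∈ F, (1 + θ * (w x + η)) := Finset.prod_filter_mul_prod_filter_not F _ _
  have hsplitw : ∑ x ∈ H, w x + ∑ x ∈ J, w x = ∑ x ∈ F, w x :=
    Finset.sum_filter_add_sum_filter_not F _ _
  have hsumH : ∑ x ∈ H, w x ≤ #H := by
    simpa using Finset.sum_le_sum fun x hx => hw1 x (hHF hx)
  have key : ∀ d : ℝ, 1 ≤ d → d ≤ ∏ x ∈ J, (1 + θ * (w x + η)) →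
      (1 + θ / 2) ^ t * (1 + θ * η) ≤ (1 + θ / 2) ^ #H * d →
      (1 + θ / 2) ^ t * (1 + θ * η) ≤ ∏ x ∈ F, (1 + θ * (w x + η)) := by
    intro d hd1 hd h
    rw [← hsplit]
    exact h.trans (mul_le_mul hprodH hd (by linarith) (le_trans (by positivity) hprodH))
  rcases lt_trichotomy #H t with hlt | heq | hgt
  · have hσ : ((t - #H : ℕ) : ℝ) < ∑ x ∈ J, w x := by
      rw [Nat.cast_sub hlt.le]
      linarith
    refine key ((1 + θ / 2) ^ (t - #H + 1)) (one_le_pow₀ hbase) ?_ ?_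
    · calc (1 + θ / 2) ^ (t - #H + 1) ≤ (1 + θ / 2) ^ (∑ x ∈ J, 2 * w x) := by
            rw [← Real.rpow_natCast]
            refine Real.rpow_le_rpow_of_exponent_le hbase ?_
            have h1 : (1 : ℝ) ≤ ((t - #H : ℕ) : ℝ) := by
              exact_mod_cast Nat.sub_pos_of_lt hlt
            rw [← Finset.mul_sum]
            push_cast
            linarith
        _ = ∏ x ∈ J, (1 + θ / 2) ^ (2 * w x) := Real.rpow_sum_of_pos (by linarith) _ _
        _ ≤ _ := by
            refine Finset.prod_le_prod (fun x _ => Real.rpow_nonneg (by linarith) _)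
              fun x hx => ?_
            have hx2 := (Finset.mem_filter.mp hx).2
            have hx0 := hw0 x (hJF hx)
            refine (rpow_one_add_le_one_add_mul_self (by linarith) (by linarith)
              (by linarith)).trans ?_
            nlinarith [mul_nonneg hθ hη]
    · rw [← pow_add, show #H + (t - #H + 1) = t + 1 by omega, pow_succ]
      exact mul_le_mul_of_nonneg_left hηle (by positivity)
  · have hJne : J.Nonempty := by
      rw [Finset.nonempty_iff_ne_empty]
      intro h
      rw [h, Finset.sum_empty] at hsplitw
      rw [heq] at hsumH
      linarith
    obtain ⟨y, hy⟩ := hJne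
    refine key (1 + θ * η) (by nlinarith [mul_nonneg hθ hη]) ?_ (by rw [heq])
    rw [← Finset.mul_prod_erase _ _ hy]
    have h1 : 1 ≤ ∏ x ∈ J.erase y, (1 + θ * (w x + η)) :=
      Finset.one_le_prod fun x hx => hone x (hJF (Finset.mem_of_mem_erase hx))
    have h2 : 1 + θ * η ≤ 1 + θ * (w y + η) := by
      nlinarith [mul_nonneg hθ (hw0 y (hJF hy))]
    have h3 := hone y (hJF hy)
    nlinarith
  · refine key 1 le_rfl hprodJ1 ?_
    rw [mul_one]
    calc (1 + θ / 2) ^ t * (1 + θ * η) ≤ (1 + θ / 2) ^ t * (1 + θ / 2) :=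
          mul_le_mul_of_nonneg_left hηle (by positivity)
      _ = (1 + θ / 2) ^ (t + 1) := (pow_succ _ _).symm
      _ ≤ _ := pow_le_pow_right₀ hbase hgt

lemma exp_le_rpow_mul_rpow_of_floor {K L G ε q : ℝ} {t : ℕ} (hK : 0 < K) (hG : 0 < G)
    (hε0 : 0 < ε) (hε1 : ε ≤ 1) (hq0 : 0 < q) (hq1 : q ≤ 1) (htL : (t + 1 : ℕ) ≤ L)
    (hLt : L < (t + 1 : ℕ) + 1) (hq : ε * (G * q ^ 2) ^ (t + 1) = 2048 ^ (t + 1)) :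
    Real.exp (K * G / L * ε * q / 4) ≤
      (1 + ε * q / (4 * Real.exp L) * ((1 + G / 2 / 2) ^ t * (1 + G / 2 * (1 / (5 * L))))) ^
        (K * G / L * ε * q / 4) * q ^ (ε * K) := by
  push_cast at htL hLt
  have ht0 : (0 : ℝ) ≤ t := Nat.cast_nonneg t
  have hL : 0 < L := by linarith
  have hGq : 2048 ≤ G * q ^ 2 := by
    have h : (2048 : ℝ) ^ (t + 1) ≤ (G * q ^ 2) ^ (t + 1) := by
      rw [← hq]
      exact mul_le_of_le_one_left (by positivity) hε1
    exact le_of_pow_le_pow_left₀ (Nat.succ_ne_zero t) (by positivity) h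
  set s := K * G / L * ε * q / 4 with hs
  set b := ε * q / (4 * Real.exp L) * ((1 + G / 2 / 2) ^ t * (1 + G / 2 * (1 / (5 * L)))) with hb
  have hs0 : 0 ≤ s := by positivity
  have hb0 : 0 ≤ b := by positivity
  have h2t : (t : ℝ) + 2 ≤ 2 * 2 ^ t := by
    have := one_add_mul_le_pow (show (-2 : ℝ) ≤ 1 by norm_num) t
    norm_num at this
    have h1 : (1 : ℝ) ≤ 2 ^ t := one_le_pow₀ (by norm_num)
    linarith
  have hB : G ^ (t + 1) / (20 * 8 ^ t) ≤ (1 + G / 2 / 2) ^ t * (1 + G / 2 * (1 / (5 * L))) := by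
    have h1 : (G / 4) ^ t ≤ (1 + G / 2 / 2) ^ t := by
      gcongr
      linarith
    have h2 : G / (20 * 2 ^ t) ≤ 1 + G / 2 * (1 / (5 * L)) := by
      have h3 : G / (20 * 2 ^ t) ≤ G / (10 * L) :=
        div_le_div_of_nonneg_left hG.le (by positivity) (by linarith)
      have h4 : G / 2 * (1 / (5 * L)) = G / (10 * L) := by
        field_simp
        norm_num
      linarith
    calc G ^ (t + 1) / (20 * 8 ^ t) = (G / 4) ^ t * (G / (20 * 2 ^ t)) := by
          rw [div_pow, pow_succ, show (8 : ℝ) = 4 * 2 by norm_num, mul_pow]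
          field_simp
      _ ≤ _ := mul_le_mul h1 h2 (by positivity) (by positivity)
  have hexpL : Real.exp L ≤ Real.exp 1 ^ (t + 2) := by
    rw [← Real.exp_nat_mul]
    refine Real.exp_le_exp.mpr ?_
    push_cast
    linarith
  have he3 : Real.exp 1 ^ 3 ≤ 21 := by
    calc Real.exp 1 ^ 3 ≤ 2.7182818286 ^ 3 := by
          gcongr
          exact Real.exp_one_lt_d9.le
      _ ≤ 21 := by norm_num
  have he : Real.exp 1 ≤ 256 := Real.exp_one_lt_d9.le.trans (by norm_num)
  have hnum : Real.exp 1 * (10 * Real.exp 1 ^ (t + 2)) ≤ 256 ^ (t + 1) := by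
    calc Real.exp 1 * (10 * Real.exp 1 ^ (t + 2)) = 10 * Real.exp 1 ^ 3 * Real.exp 1 ^ t := by ring
      _ ≤ 256 * 256 ^ t := by
          gcongr
          linarith
      _ = 256 ^ (t + 1) := by ring
  have hbase : Real.exp 1 ≤ (1 + b) * q ^ (t + 1) := by
    have hqpow : (q ^ 2) ^ (t + 1) ≤ q * q ^ (t + 1) := by
      rw [← pow_mul, ← pow_succ']
      exact pow_le_pow_of_le_one hq0.le hq1 (by omega)
    calc Real.exp 1 ≤ 256 ^ (t + 1) / (10 * Real.exp 1 ^ (t + 2)) := by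
          rw [le_div_iff₀ (by positivity)]
          exact hnum
      _ = ε * (G * q ^ 2) ^ (t + 1) / (8 ^ (t + 1) * (10 * Real.exp 1 ^ (t + 2))) := by
          rw [hq, show (2048 : ℝ) = 8 * 256 by norm_num, mul_pow]
          field_simp
      _ = ε / (4 * Real.exp 1 ^ (t + 2)) * (G ^ (t + 1) / (20 * 8 ^ t)) * (q ^ 2) ^ (t + 1) := by
          rw [mul_pow, pow_succ (8 : ℝ)]
          field_simp
          norm_num
      _ ≤ ε / (4 * Real.exp L) * ((1 + G / 2 / 2) ^ t * (1 + G / 2 * (1 / (5 * L)))) *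
            (q * q ^ (t + 1)) := by
          gcongr
      _ = b * q ^ (t + 1) := by
          rw [hb]
          ring
      _ ≤ (1 + b) * q ^ (t + 1) := by
          gcongr
          linarith
  have hexponent : ε * K ≤ (t + 1 : ℕ) * s := by
    push_cast
    have h1 : G * q ^ 2 ≤ G * q := by
      gcongr
      nlinarith
    have h2 : 4 * L ≤ (t + 1) * (G * q) := by nlinarith
    calc ε * K = ε * K / (4 * L) * (4 * L) := by field_simp
      _ ≤ ε * K / (4 * L) * ((t + 1) * (G * q)) := by gcongr
      _ = (t + 1) * s := by
          rw [hs]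
          field_simp
  calc Real.exp s = Real.exp 1 ^ s := by rw [Real.exp_one_rpow]
    _ ≤ ((1 + b) * q ^ (t + 1)) ^ s := Real.rpow_le_rpow (Real.exp_pos _).le hbase hs0
    _ = (1 + b) ^ s * q ^ ((t + 1 : ℕ) * s) := by
        rw [Real.mul_rpow (by positivity) (by positivity), ← Real.rpow_natCast q,
          ← Real.rpow_mul hq0.le]
    _ ≤ (1 + b) ^ s * q ^ (ε * K) :=
        mul_le_mul_of_nonneg_left (Real.rpow_le_rpow_of_exponent_ge hq0 hq1 hexponent)
          (by positivity)

lemma exp_le_rpow_mul_rpow_of_le {K L ε q : ℝ} (hK : 0 < K) (hL : 1 ≤ L) (hε0 : 0 < ε)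
    (hq0 : 0 < q) (hq1 : q ≤ 1) :
    Real.exp (4 / q * (4 * K * L) * (ε * q / 4)) ≤
      (1 + 4 / q) ^ (4 * K * L * ε) * q ^ (ε * K) := by
  have hexponent : ε * K ≤ 4 * K * L * ε := by nlinarith [mul_pos hε0 hK]
  have hbase : Real.exp 1 ≤ (1 + 4 / q) * q := by
    have h : (1 + 4 / q) * q = q + 4 := by field_simp
    have := Real.exp_one_lt_d9
    rw [h]
    linarith
  have hpos : 0 ≤ 4 * K * L * ε := by positivity
  calc Real.exp (4 / q * (4 * K * L) * (ε * q / 4)) = Real.exp 1 ^ (4 * K * L * ε) := by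
        rw [Real.exp_one_rpow]
        congr 1
        field_simp
    _ ≤ ((1 + 4 / q) * q) ^ (4 * K * L * ε) :=
        Real.rpow_le_rpow (Real.exp_pos _).le hbase hpos
    _ = (1 + 4 / q) ^ (4 * K * L * ε) * q ^ (4 * K * L * ε) :=
        Real.mul_rpow (by positivity) hq0.le
    _ ≤ _ := mul_le_mul_of_nonneg_left (Real.rpow_le_rpow_of_exponent_ge hq0 hq1 hexponent)
        (by positivity)

/-- a random function jointly condenses the subdistributions on the
heavy part `X₁` (the `min{⌈4KL⌉, N}` highest-probability elements of the support)
and the light part `X₂` (the rest). -/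
theorem stmt15 (n m : ℕ) (k ℓ g ε : ℝ) (p : BS n → ℝ) (X₁ X₂ : Finset (BS n))
    (hp : IsDist p) (hk : ∀ x, p x ≤ (2 : ℝ) ^ (-k))
    (hℓ0 : 0 ≤ ℓ) (hℓk : ℓ ≤ k) (hg : 0 ≤ g) (hm : (m : ℝ) = k - ℓ + g)
    (hε0 : 0 < ε) (hε1 : ε ≤ 1)
    (hunion : X₁ ∪ X₂ = supp p) (hdisj : Disjoint X₁ X₂)
    (hcard : X₁.card =
      min (min ⌈4 * (2 : ℝ) ^ k * (2 : ℝ) ^ ℓ⌉₊ (2 ^ n)) (supp p).card)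
    (horder : ∀ x₁ ∈ X₁, ∀ x₂ ∈ X₂, p x₂ ≤ p x₁) :
    prF n m (fun f => ∃ S : Finset (BS m),
        (∀ v ∈ S, prX p (fun x => f x = v ∧ x ∈ X₁) >
          (((2 : ℝ) ^ ℓ - 1) / (2 : ℝ) ^ ℓ) * (1 / (2 : ℝ) ^ (k - ℓ))) ∧
        prX p (fun x => f x ∈ S ∧ x ∈ X₂) > ε)
      ≤ 2 * (2 : ℝ) ^ (-(ε * (2 : ℝ) ^ k / 2) *
          (g - (1 / (⌊(2 : ℝ) ^ ℓ⌋ : ℝ)) * Real.logb 2 (1 / ε) - 11)) := by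
  set K := (2 : ℝ) ^ k with hKdef
  set L := (2 : ℝ) ^ ℓ with hLdef
  set D := g - (1 / (⌊L⌋ : ℝ)) * Real.logb 2 (1 / ε) - 11 with hD
  have hK1 : 1 ≤ K := Real.one_le_rpow (by norm_num) (hℓ0.trans hℓk)
  have hL1 : 1 ≤ L := Real.one_le_rpow (by norm_num) hℓ0
  have hK : 0 < K := by linarith
  have hL : 0 < L := by linarith
  have hN : (0 : ℝ) < Fintype.card (BS n → BS m) := by exact_mod_cast Fintype.card_pos
  rcases le_or_gt D 0 with hD0 | hD0
  · have h1 : (1 : ℝ) ≤ 2 ^ (-(ε * K / 2) * D) := by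
      refine Real.one_le_rpow (by norm_num) ?_
      nlinarith [mul_pos hε0 hK]
    refine le_trans ?_ (show (1 : ℝ) ≤ _ by linarith)
    rw [prF, div_le_one hN]
    exact_mod_cast Finset.card_le_univ _
  set G := (2 : ℝ) ^ g with hGdef
  have hG : 0 < G := by positivity
  set q := (2 : ℝ) ^ (-(D / 2)) with hqdef
  have hq0 : 0 < q := by positivity
  have hq1 : q ≤ 1 := Real.rpow_le_one_of_one_le_of_nonpos (by norm_num) (by linarith)
  have hM : (Fintype.card (BS m) : ℝ) = K * G / L := by
    rw [hKdef, hGdef, hLdef, ← Real.rpow_add (by norm_num), ← Real.rpow_sub (by norm_num),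
      show k + g - ℓ = (m : ℝ) by linarith, Real.rpow_natCast]
    simp
  have hrhs : (2 : ℝ) ^ (-(ε * K / 2) * D) = q ^ (ε * K) := by
    rw [hqdef, ← Real.rpow_mul (by norm_num)]
    congr 1
    ring
  obtain ⟨t, ht⟩ : ∃ t : ℕ, ⌊L⌋ = ((t + 1 : ℕ) : ℤ) := by
    have h1 : 1 ≤ ⌊L⌋ := Int.le_floor.mpr (by exact_mod_cast hL1)
    exact ⟨(⌊L⌋ - 1).toNat, by omega⟩
  have htL : ((t + 1 : ℕ) : ℝ) ≤ L := by
    have := Int.floor_le L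
    rw [ht] at this
    exact_mod_cast this
  have hLt : L < ((t + 1 : ℕ) : ℝ) + 1 := by
    have := Int.lt_floor_add_one L
    rw [ht] at this
    exact_mod_cast this
  have hGq : ε * (G * q ^ 2) ^ (t + 1) = 2048 ^ (t + 1) := by
    have hε : ε = (2 : ℝ) ^ (Real.logb 2 ε) :=
      (Real.rpow_logb (by norm_num) (by norm_num) hε0).symm
    have h2048 : (2048 : ℝ) = 2 ^ (11 : ℝ) := by norm_num
    rw [ht, one_div ε, Real.logb_inv] at hD
    rw [h2048, hε, hGdef, hqdef, ← Real.rpow_natCast _ (t + 1), ← Real.rpow_natCast _ (t + 1),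
      ← Real.rpow_natCast _ 2, ← Real.rpow_mul (by norm_num), ← Real.rpow_add (by norm_num),
      ← Real.rpow_mul (by norm_num), ← Real.rpow_mul (by norm_num), ← Real.rpow_add (by norm_num)]
    congr 1
    rw [hD]
    push_cast
    field_simp
    ring
  have hp0 := hp.1
  have hsub_le_one : ∀ A : Finset (BS n), ∑ x ∈ A, p x ≤ 1 := fun A =>
    hp.2 ▸ Finset.sum_le_sum_of_subset_of_nonneg (Finset.subset_univ A) fun x _ _ => hp0 x
  have hKp : ∀ x, K * p x ≤ 1 := fun x => by
    have h := hk x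
    rw [Real.rpow_neg (by norm_num), ← hKdef] at h
    calc K * p x ≤ K * K⁻¹ := by gcongr
      _ = 1 := mul_inv_cancel₀ hK.ne'
  have hX₁card : (#X₁ : ℝ) ≤ 5 * K * L := by
    have h1 : #X₁ ≤ ⌈4 * K * L⌉₊ := by
      rw [hcard]
      exact (min_le_left _ _).trans (min_le_left _ _)
    have h2 : (⌈4 * K * L⌉₊ : ℝ) < 4 * K * L + 1 := Nat.ceil_lt_add_one (by positivity)
    have h3 : (#X₁ : ℝ) ≤ (⌈4 * K * L⌉₊ : ℝ) := by exact_mod_cast h1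
    nlinarith
  have hlight : ∀ x ∈ X₂, 4 * K * L * p x ≤ 1 := by
    intro x hx
    have h1 : #X₁ + #X₂ = #(supp p) := by
      rw [← hunion, Finset.card_union_of_disjoint hdisj]
    have h2 : 0 < #X₂ := Finset.card_pos.mpr ⟨x, hx⟩
    have h3 : #(supp p) ≤ 2 ^ n := by
      simpa using Finset.card_le_univ (supp p)
    have h4 : ⌈4 * K * L⌉₊ ≤ #X₁ := by omega
    have h5 : 4 * K * L ≤ #X₁ := (Nat.le_ceil _).trans (by exact_mod_cast h4)
    calc 4 * K * L * p x ≤ #X₁ * p x := mul_le_mul_of_nonneg_right h5 (hp0 x)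
      _ = ∑ _y ∈ X₁, p x := by simp
      _ ≤ ∑ y ∈ X₁, p y := Finset.sum_le_sum fun y hy => horder y hy x hx
      _ ≤ 1 := hsub_le_one X₁
  let T : (BS n → BS m) → Finset (BS m) := fun f =>
    {v | (L - 1) / K < ∑ x ∈ X₁ with f x = v, p x}
  have hTdep : ∀ f f' : BS n → BS m, (∀ x ∈ X₁, f x = f' x) → T f = T f' := by
    intro f f' h
    have hfil : ∀ v, {x ∈ X₁ | f x = v} = {x ∈ X₁ | f' x = v} := fun v =>
      Finset.filter_congr fun x hx => by rw [h x hx]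
    simp only [T, hfil]
  let c : BS n → ℝ := fun x => G / 2 * (K * p x + 1 / (5 * L))
  have hc0 : ∀ x ∈ X₁, 0 ≤ c x := fun x _ => by
    have := hp0 x
    positivity
  have hcsum : (∑ x ∈ X₁, c x) / Fintype.card (BS m) ≤ L := by
    rw [hM, div_le_iff₀ (by positivity)]
    calc ∑ x ∈ X₁, c x = G / 2 * (K * ∑ x ∈ X₁, p x + #X₁ * (1 / (5 * L))) := by
          simp only [c]
          rw [← Finset.mul_sum, Finset.sum_add_distrib, ← Finset.mul_sum, Finset.sum_const,
            nsmul_eq_mul]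
      _ ≤ G / 2 * (K * 1 + 5 * K * L * (1 / (5 * L))) := by
          gcongr
          exact hsub_le_one X₁
      _ = L * (K * G / L) := by
          field_simp
          ring
  set B := (1 + G / 2 / 2) ^ t * (1 + G / 2 * (1 / (5 * L))) with hB
  have hB0 : 0 ≤ B := by positivity
  have hTB : ∀ f, ∀ v ∈ T f, B ≤ ∏ x ∈ X₁ with f x = v, (1 + c x) := by
    intro f v hv
    have hv' : (L - 1) / K < ∑ x ∈ X₁ with f x = v, p x := by simpa [T] using hv
    refine pow_mul_le_prod_one_add _ (fun x => K * p x) t (by positivity) (by positivity) ?_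
      (fun x _ => mul_nonneg hK.le (hp0 x)) (fun x _ => hKp x) ?_
    · rw [div_le_div_iff₀ (by positivity) (by norm_num)]
      linarith
    · rw [← Finset.mul_sum]
      rw [div_lt_iff₀ hK] at hv'
      push_cast at htL
      linarith
  set s := K * G / L * ε * q / 4 with hs
  set r := ε * q / (4 * Real.exp L) with hr
  have hr0 : 0 ≤ r := by positivity
  have hmany : (#{f : BS n → BS m | s ≤ #(T f)} : ℝ) ≤
      Fintype.card (BS n → BS m) * q ^ (ε * K) := by
    have h1 := card_filter_le_card_mul_rpow_le X₁ c hc0 hB0 hr0 (s := s) T hTB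
    have h2 : Real.exp (r * Real.exp ((∑ x ∈ X₁, c x) / Fintype.card (BS m)) *
        Fintype.card (BS m)) ≤ Real.exp s := by
      refine Real.exp_le_exp.mpr ?_
      calc r * Real.exp ((∑ x ∈ X₁, c x) / Fintype.card (BS m)) * Fintype.card (BS m)
          ≤ r * Real.exp L * Fintype.card (BS m) := by gcongr
        _ = s := by
            rw [hM, hr, hs]
            field_simp
    have h3 := exp_le_rpow_mul_rpow_of_floor hK hG hε0 hε1 hq0 hq1 htL hLt hGq
    have hpos : 0 < (1 + r * B) ^ s := Real.rpow_pos_of_pos (by positivity) _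
    refine le_of_mul_le_mul_right ?_ hpos
    calc (#{f : BS n → BS m | s ≤ #(T f)} : ℝ) * (1 + r * B) ^ s
        ≤ Fintype.card (BS n → BS m) * ((1 + r * B) ^ s * q ^ (ε * K)) :=
          h1.trans (mul_le_mul_of_nonneg_left (h2.trans h3) hN.le)
      _ = Fintype.card (BS n → BS m) * q ^ (ε * K) * (1 + r * B) ^ s := by ring
  have hfew : (#{f : BS n → BS m | (#(T f) : ℝ) < ε * q / 4 * Fintype.card (BS m) ∧
      ε < ∑ x ∈ X₂ with f x ∈ T f, p x} : ℝ) ≤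
      Fintype.card (BS n → BS m) * q ^ (ε * K) := by
    have h1 := card_filter_lt_sum_mem_dep_mul_le X₁ X₂ hdisj T hTdep p (R := 4 * K * L) (ε := ε)
      (q := ε * q / 4) (φ := 4 / q) (by positivity) (by positivity) (fun x _ => hp0 x) hlight
      (hsub_le_one X₂)
    have h2 := exp_le_rpow_mul_rpow_of_le hK hL1 hε0 hq0 hq1
    have hpos : 0 < (1 + 4 / q) ^ (4 * K * L * ε) := Real.rpow_pos_of_pos (by positivity) _
    refine le_of_mul_le_mul_right ?_ hpos
    refine (h1.trans (mul_le_mul_of_nonneg_left h2 hN.le)).trans_eq ?_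
    ring
  have hthreshold : (L - 1) / L * (1 / (2 : ℝ) ^ (k - ℓ)) = (L - 1) / K := by
    rw [Real.rpow_sub (by norm_num), ← hKdef, ← hLdef]
    field_simp
  rw [hrhs, prF, div_le_iff₀ hN]
  refine le_trans (b := ((#{f : BS n → BS m | s ≤ #(T f)} +
    #{f : BS n → BS m | (#(T f) : ℝ) < ε * q / 4 * Fintype.card (BS m) ∧
      ε < ∑ x ∈ X₂ with f x ∈ T f, p x} : ℕ) : ℝ)) ?_ (by push_cast; linarith)
  refine Nat.cast_le.mpr ((Finset.card_le_card ?_).trans (Finset.card_union_le _ _))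
  intro f hf
  simp only [Finset.mem_filter, Finset.mem_univ, true_and] at hf
  obtain ⟨S, hS, hSε⟩ := hf
  rw [Finset.mem_union, Finset.mem_filter, Finset.mem_filter]
  by_cases hsT : s ≤ #(T f)
  · exact Or.inl ⟨Finset.mem_univ _, hsT⟩
  refine Or.inr ⟨Finset.mem_univ _, ?_, ?_⟩
  · rw [hM]
    refine (not_le.mp hsT).trans_eq ?_
    rw [hs]
    ring
  · have hST : S ⊆ T f := by
      intro v hv
      have h := hS v hv
      rw [hthreshold, prX] at h
      have hfil : {x ∈ X₁ | f x = v} = ({x | f x = v ∧ x ∈ X₁} : Finset (BS n)) := by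
        ext x
        simp [and_comm]
      simp only [T, Finset.mem_filter, Finset.mem_univ, true_and, hfil]
      convert h
    refine hSε.lt.trans_le ?_
    rw [prX]
    refine Finset.sum_le_sum_of_subset_of_nonneg ?_ fun x _ _ => hp0 x
    intro x hx
    simp only [Finset.mem_filter, Finset.mem_univ, true_and] at hx ⊢
    exact ⟨hx.2, hST hx.1⟩
end

section
/- For all real g ≥ 0 and all real α > 0, writing G := 2^g, the function φ(α,g) := (1+α)·(ln G + ln(1 + 1/α) − 1) + α/G satisfies φ(α,g) ≥ g·ln 2. -/
open Real

/-- for all `g ≥ 0` and `α > 0`, with `G := 2^g`,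
`φ(α,g) := (1+α)(ln G + ln(1+1/α) − 1) + α/G ≥ g·ln 2`. -/
theorem stmt16 (g α : ℝ) (hg : 0 ≤ g) (hα : 0 < α) :
    (1 + α) * (Real.log ((2 : ℝ) ^ g) + Real.log (1 + 1 / α) - 1)
        + α / (2 : ℝ) ^ g
      ≥ g * Real.log 2 := by
  have hG : (0 : ℝ) < 2 ^ g := by positivity
  have hlogG : 1 - ((2 : ℝ) ^ g)⁻¹ ≤ Real.log ((2 : ℝ) ^ g) :=
    Real.one_sub_inv_le_log_of_pos hG
  have hlogα : 1 - (1 + 1 / α)⁻¹ ≤ Real.log (1 + 1 / α) :=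
    Real.one_sub_inv_le_log_of_pos (by positivity)
  have hmulα : (1 + α) * (1 - (1 + 1 / α)⁻¹) = 1 := by
    field_simp
    ring
  have hα_le := mul_le_mul_of_nonneg_left hlogα (by positivity : 0 ≤ 1 + α)
  have hG_le := mul_le_mul_of_nonneg_left hlogG hα.le
  rw [← Real.log_rpow two_pos, div_eq_mul_inv α]
  linarith
end
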